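/- arXiv:2508.04370 — 3 statements merged into one kernel-verified Lean document; each statement's English description precedes it below -/
import Mathlib

section
/- Let E be a symmetric positive definite n×n real matrix, F a symmetric positive definite m×m real matrix, and A an m×n real matrix. Then the (n+m)×(n+m) symmetric matrix with block form [[−E, Aᵀ],[A, F]] is invertible. -/
open Matrix

/-- A quasi-definite matrix `[[−E, Aᵀ], [A, F]]`, with `E` and `F` symmetric
positive definite, is invertible. -/
theorem quasiDefinite_isUnit
    {n m : ℕ} (E : Matrix (Fin n) (Fin n) ℝ) (hE : E.PosDef)
    (F : Matrix (Fin m) (Fin m) ℝ) (hF : F.PosDef)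
    (A : Matrix (Fin m) (Fin n) ℝ) :
    IsUnit (Matrix.fromBlocks (-E) Aᵀ A F) := by
  have := hF.isUnit.invertible
  rw [isUnit_fromBlocks_iff_of_invertible₂₂, invOf_eq_nonsing_inv, sub_eq_add_neg, ← neg_add,
    IsUnit.neg_iff]
  have hS : (Aᵀ * F⁻¹ * A).PosSemidef := by
    simpa using hF.inv.posSemidef.conjTranspose_mul_mul_same A
  exact (hE.add_posSemidef hS).isUnit
end

section
/- Let E be a symmetric positive definite n×n real matrix, F a symmetric positive definite m×m real matrix, and A an m×n real matrix, and let K be the (n+m)×(n+m) quasi-definite matrix with block form [[−E, Aᵀ],[A, F]]. Then there exist a unit lower triangular real matrix L (lower triangular with all diagonal entries equal to 1) and a diagonal real matrix D such that K = L·D·Lᵀ, where the first n diagonal entries of D are strictly negative and the last m diagonal entries of D are strictly positive. -/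
open Matrix

/-- A linear map that vanishes on the earlier Gram-Schmidt vectors takes the same value on
`gramSchmidt 𝕜 f i` and on `f i`. -/
theorem InnerProductSpace.map_gramSchmidt_eq {𝕜 V W n : Type*} [RCLike 𝕜] [NormedAddCommGroup V]
    [InnerProductSpace 𝕜 V] [AddCommGroup W] [Module 𝕜 W] [LinearOrder n]
    [LocallyFiniteOrderBot n] [WellFoundedLT n] (f : n → V) (φ : V →ₗ[𝕜] W) (i : n)
    (h : ∀ j < i, φ (gramSchmidt 𝕜 f j) = 0) : φ (gramSchmidt 𝕜 f i) = φ (f i) := by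
  rw [gramSchmidt_def, map_sub, map_sum, Finset.sum_eq_zero, sub_zero]
  intro j hj
  obtain ⟨c, hc⟩ := Submodule.mem_span_singleton.mp
    ((𝕜 ∙ gramSchmidt 𝕜 f j).starProjection_apply_mem (f i))
  rw [← hc, map_smul, h j (Finset.mem_Iio.mp hj), smul_zero]

open scoped ComplexOrder in
/-- In the LDL decomposition, the inverse of the lower factor has unit diagonal. -/
theorem LDL.lowerInv_diag {𝕜 n : Type*} [RCLike 𝕜] [LinearOrder n] [WellFoundedLT n]
    [LocallyFiniteOrderBot n] [Fintype n] {S : Matrix n n 𝕜} (hS : S.PosDef) (i : n) :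
    LDL.lowerInv hS i i = 1 := by
  have h := @InnerProductSpace.map_gramSchmidt_eq 𝕜 (n → 𝕜) 𝕜 n _
    (Sᵀ.toNormedAddCommGroup hS.transpose) (Sᵀ.toInnerProductSpace hS.transpose.posSemidef)
    _ _ _ _ _ (Pi.basisFun 𝕜 n) (LinearMap.proj i) i
    (fun j hj => LDL.lowerInv_triangular hS hj)
  refine h.trans ?_
  simp

/-- A positive definite real matrix has an `L·D·Lᵀ` factorisation with `L` unit lower triangular
and `D` diagonal with positive entries. -/
theorem Matrix.PosDef.exists_ldlt {n : ℕ} {S : Matrix (Fin n) (Fin n) ℝ} (hS : S.PosDef) :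
    ∃ (L : Matrix (Fin n) (Fin n) ℝ) (d : Fin n → ℝ),
      (∀ i j, i < j → L i j = 0) ∧ (∀ i, L i i = 1) ∧ (∀ i, 0 < d i) ∧
      S = L * diagonal d * Lᵀ := by
  have hM : (LDL.lowerInv hS).IsLowerTriangular := fun i j hij => LDL.lowerInv_triangular hS hij
  have hL : (LDL.lower hS).IsLowerTriangular := blockTriangular_inv_of_blockTriangular hM
  have hpos : (LDL.diag hS).PosDef := by
    rw [LDL.diag_eq_lowerInv_conj]
    refine hS.mul_mul_conjTranspose_same ?_
    exact vecMul_injective_of_isUnit (isUnit_of_invertible _)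
  refine ⟨LDL.lower hS, LDL.diagEntries hS, fun i j hij => hL hij, fun i => ?_, fun i => ?_, ?_⟩
  · have h : (LDL.lowerInv hS * LDL.lower hS) i i = 1 := by
      rw [LDL.lower, mul_inv_of_invertible, one_apply_eq]
    rw [mul_apply, Finset.sum_eq_single i, LDL.lowerInv_diag, one_mul] at h
    · exact h
    · intro j _ hji
      rcases lt_or_gt_of_ne hji with hlt | hgt
      · rw [hL (show OrderDual.toDual i < OrderDual.toDual j from hlt), mul_zero]
      · rw [hM (show OrderDual.toDual j < OrderDual.toDual i from hgt), zero_mul]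
    · simp
  · simpa [LDL.diag] using hpos.diag_pos (i := i)
  · simpa [LDL.diag] using (LDL.lower_conj_diag hS).symm

/-- Block form of the factorisation: an `L·D·Lᵀ` factorisation of `E` and one of the Schur
complement `F + A * E⁻¹ * Aᵀ` combine into one of `[[−E, Aᵀ], [A, F]]`. -/
theorem Matrix.fromBlocks_neg_eq_ldlt {l k : Type*} [Fintype l] [DecidableEq l]
    [Fintype k] [DecidableEq k] {E L₁ : Matrix l l ℝ} {F L₂ : Matrix k k ℝ} {A : Matrix k l ℝ}
    {d₁ : l → ℝ} {d₂ : k → ℝ} (hE : IsUnit E.det) (h₁ : E = L₁ * diagonal d₁ * L₁ᵀ)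
    (h₂ : F + A * E⁻¹ * Aᵀ = L₂ * diagonal d₂ * L₂ᵀ) :
    fromBlocks (-E) Aᵀ A F =
      fromBlocks L₁ 0 (-(A * E⁻¹ * L₁)) L₂ * diagonal (Sum.elim (-d₁) d₂) *
        (fromBlocks L₁ 0 (-(A * E⁻¹ * L₁)) L₂)ᵀ := by
  have hsymm : Eᵀ = E := by
    rw [h₁]; simp [Matrix.mul_assoc]
  have hd : diagonal (-d₁) = -diagonal d₁ := (diagonal_neg d₁).symm
  have hF : F = L₂ * diagonal d₂ * L₂ᵀ - A * E⁻¹ * Aᵀ := eq_sub_of_add_eq h₂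
  have hX : L₁ * (diagonal d₁ * (L₁ᵀ * (E⁻¹ * Aᵀ))) = Aᵀ := by
    rw [← Matrix.mul_assoc (diagonal d₁), ← Matrix.mul_assoc, ← Matrix.mul_assoc L₁, ← h₁,
      mul_nonsing_inv_cancel_left _ _ hE]
  have hY : A * (E⁻¹ * (L₁ * (diagonal d₁ * L₁ᵀ))) = A := by
    rw [← Matrix.mul_assoc L₁, ← h₁, nonsing_inv_mul _ hE, Matrix.mul_one]
  rw [← fromBlocks_diagonal, fromBlocks_transpose, fromBlocks_multiply, fromBlocks_multiply,
    fromBlocks_inj, hd]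
  generalize diagonal d₁ = D at h₁ hX hY ⊢
  refine ⟨?_, ?_, ?_, ?_⟩
  · simp [h₁]
  · simp [transpose_nonsing_inv, hsymm, Matrix.mul_assoc, hX]
  · simp [Matrix.mul_assoc, hY]
  · rw [hF]
    simp [transpose_nonsing_inv, hsymm, Matrix.mul_assoc, hX]
    abel

/-- A quasi-definite matrix `K = [[−E, Aᵀ], [A, F]]` (with `E`, `F` symmetric
positive definite) admits an `L·D·Lᵀ` factorisation with `L` unit lower
triangular and `D` diagonal, where the first `n` diagonal entries of `D` are
strictly negative and the last `m` are strictly positive. -/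
theorem quasiDefinite_ldlt
    {n m : ℕ} (E : Matrix (Fin n) (Fin n) ℝ) (hE : E.PosDef)
    (F : Matrix (Fin m) (Fin m) ℝ) (hF : F.PosDef)
    (A : Matrix (Fin m) (Fin n) ℝ) :
    letI K : Matrix (Fin (n + m)) (Fin (n + m)) ℝ :=
      Matrix.reindex finSumFinEquiv finSumFinEquiv (Matrix.fromBlocks (-E) Aᵀ A F)
    ∃ L D : Matrix (Fin (n + m)) (Fin (n + m)) ℝ,
      (∀ i j : Fin (n + m), i < j → L i j = 0) ∧
      (∀ i : Fin (n + m), L i i = 1) ∧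
      (∀ i j : Fin (n + m), i ≠ j → D i j = 0) ∧
      K = L * D * Lᵀ ∧
      (∀ i : Fin (n + m), (i : ℕ) < n → D i i < 0) ∧
      (∀ i : Fin (n + m), n ≤ (i : ℕ) → 0 < D i i) := by
  have hS : (F + A * E⁻¹ * Aᵀ).PosDef := by
    simpa using hF.add_posSemidef (hE.inv.posSemidef.mul_mul_conjTranspose_same A)
  obtain ⟨L₁, d₁, hL₁, hL₁', hd₁, h₁⟩ := hE.exists_ldlt
  obtain ⟨L₂, d₂, hL₂, hL₂', hd₂, h₂⟩ := hS.exists_ldlt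
  have hdet : IsUnit E.det := (isUnit_iff_isUnit_det E).mp hE.isUnit
  have hK := fromBlocks_neg_eq_ldlt hdet h₁ h₂
  refine ⟨reindex finSumFinEquiv finSumFinEquiv (fromBlocks L₁ 0 (-(A * E⁻¹ * L₁)) L₂),
    reindex finSumFinEquiv finSumFinEquiv (diagonal (Sum.elim (-d₁) d₂)), ?_, ?_, ?_, ?_, ?_, ?_⟩
  · intro i j hij
    cases i using Fin.addCases <;> cases j using Fin.addCases
    · simpa using hL₁ _ _ ((Fin.castAddOrderEmb m).lt_iff_lt.mp hij)
    · simp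
    · simp [Fin.lt_def] at hij
      omega
    · simpa using hL₂ _ _ (by simpa using hij)
  · intro i
    cases i using Fin.addCases <;> simp [hL₁', hL₂']
  · intro i j hij
    simpa using diagonal_apply_ne _ (finSumFinEquiv.symm.injective.ne hij)
  · simp only [reindex_apply, transpose_submatrix, submatrix_mul_equiv, ← hK]
  · intro i hi
    cases i using Fin.addCases with
    | left i => simpa using hd₁ i
    | right i => exact absurd hi (by simp)
  · intro i hi
    cases i using Fin.addCases with
    | left i => exact absurd i.isLt hi.not_gt
    | right i => simpa using hd₂ i
end

section
/- Let E be a symmetric positive definite n×n real matrix, F a symmetric positive definite m×m real matrix, and A an m×n real matrix, and let K be the (n+m)×(n+m) symmetric matrix with block form [[−E, Aᵀ],[A, F]]. Then K has exactly n strictly negative eigenvalues and exactly m strictly positive eigenvalues (counted with multiplicity); in particular 0 is not an eigenvalue of K. -/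
open Matrix

/-- The quadratic form of a real symmetric matrix in its eigenvector coordinates. -/
theorem Matrix.IsHermitian.dotProduct_mulVec_eq_sum_eigenvalues {ι : Type*} [Fintype ι]
    [DecidableEq ι] {K : Matrix ι ι ℝ} (hK : K.IsHermitian) (y : ι → ℝ) :
    y ⬝ᵥ K *ᵥ y =
      ∑ i, hK.eigenvalues i * ((hK.eigenvectorUnitary : Matrix ι ι ℝ)ᵀ *ᵥ y) i ^ 2 := by
  conv_lhs => rw [hK.spectral_theorem, Unitary.conjStarAlgAut_apply]
  rw [← mulVec_mulVec, ← mulVec_mulVec, dotProduct_mulVec, ← mulVec_transpose,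
    star_eq_conjTranspose, conjTranspose_eq_transpose_of_trivial]
  simp only [dotProduct, mulVec_diagonal]
  refine Finset.sum_congr rfl fun i _ => ?_
  simp only [Function.comp_apply, RCLike.ofReal_real_eq_id, id_eq]
  ring

/-- A linear map whose image meets the common kernel of the coordinates in `p` trivially has
domain of dimension at most the number of those coordinates. -/
theorem finrank_le_card_of_forall_eq_zero {V ι : Type*} [AddCommGroup V] [Module ℝ V]
    (p : ι → Prop) [Fintype {i // p i}] (f : V →ₗ[ℝ] ι → ℝ)
    (h : ∀ x, (∀ i, p i → f x i = 0) → x = 0) :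
    Module.finrank ℝ V ≤ Fintype.card {i // p i} := by
  have hinj : Function.Injective ((LinearMap.funLeft ℝ ℝ (Subtype.val : {i // p i} → ι)) ∘ₗ f) :=
    (injective_iff_map_eq_zero _).2 fun x hx => h x fun i hi => congrFun hx ⟨i, hi⟩
  simpa using LinearMap.finrank_le_finrank_of_injective hinj

/-- A symmetric matrix that is negative definite on the range of `g` has at least as many negative
eigenvalues as the dimension of the domain of `g`. -/
theorem Matrix.IsHermitian.finrank_le_card_eigenvalues_neg {V ι : Type*} [AddCommGroup V]
    [Module ℝ V] [Fintype ι] [DecidableEq ι] {K : Matrix ι ι ℝ} (hK : K.IsHermitian)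
    (g : V →ₗ[ℝ] ι → ℝ) (h : ∀ x, x ≠ 0 → g x ⬝ᵥ K *ᵥ g x < 0) :
    Module.finrank ℝ V ≤ Fintype.card {i // hK.eigenvalues i < 0} := by
  refine finrank_le_card_of_forall_eq_zero _
    (Matrix.mulVecLin (hK.eigenvectorUnitary : Matrix ι ι ℝ)ᵀ ∘ₗ g) fun x hx => ?_
  by_contra hne
  refine (h x hne).not_ge ?_
  rw [hK.dotProduct_mulVec_eq_sum_eigenvalues]
  refine Finset.sum_nonneg fun i _ => ?_
  rcases lt_or_ge (hK.eigenvalues i) 0 with hi | hi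
  · have := hx i hi
    simp only [LinearMap.comp_apply, mulVecLin_apply] at this
    simp [this]
  · positivity

/-- A symmetric matrix that is positive definite on the range of `g` has at least as many positive
eigenvalues as the dimension of the domain of `g`. -/
theorem Matrix.IsHermitian.finrank_le_card_eigenvalues_pos {V ι : Type*} [AddCommGroup V]
    [Module ℝ V] [Fintype ι] [DecidableEq ι] {K : Matrix ι ι ℝ} (hK : K.IsHermitian)
    (g : V →ₗ[ℝ] ι → ℝ) (h : ∀ x, x ≠ 0 → 0 < g x ⬝ᵥ K *ᵥ g x) :
    Module.finrank ℝ V ≤ Fintype.card {i // 0 < hK.eigenvalues i} := by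
  refine finrank_le_card_of_forall_eq_zero _
    (Matrix.mulVecLin (hK.eigenvectorUnitary : Matrix ι ι ℝ)ᵀ ∘ₗ g) fun x hx => ?_
  by_contra hne
  refine (h x hne).not_ge ?_
  rw [hK.dotProduct_mulVec_eq_sum_eigenvalues]
  refine Finset.sum_nonpos fun i _ => ?_
  rcases lt_or_ge 0 (hK.eigenvalues i) with hi | hi
  · have := hx i hi
    simp only [LinearMap.comp_apply, mulVecLin_apply] at this
    simp [this]
  · exact mul_nonpos_of_nonpos_of_nonneg hi (sq_nonneg _)

/-- Inertia of a quasi-definite matrix: `K = [[−E, Aᵀ], [A, F]]` with `E`, `F`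
symmetric positive definite has exactly `n` strictly negative and `m` strictly
positive eigenvalues (with multiplicity); in particular `0` is not an
eigenvalue of `K`. -/
theorem quasiDefinite_inertia
    {n m : ℕ} (E : Matrix (Fin n) (Fin n) ℝ) (hE : E.PosDef)
    (F : Matrix (Fin m) (Fin m) ℝ) (hF : F.PosDef)
    (A : Matrix (Fin m) (Fin n) ℝ)
    (hK : (Matrix.fromBlocks (-E) Aᵀ A F).IsHermitian) :
    Fintype.card {i : Fin n ⊕ Fin m // hK.eigenvalues i < 0} = n ∧
    Fintype.card {i : Fin n ⊕ Fin m // 0 < hK.eigenvalues i} = m ∧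
    ∀ i : Fin n ⊕ Fin m, hK.eigenvalues i ≠ 0 := by
  have hneg : n ≤ Fintype.card {i // hK.eigenvalues i < 0} := by
    have := hK.finrank_le_card_eigenvalues_neg
      ((LinearEquiv.sumArrowLequivProdArrow (Fin n) (Fin m) ℝ ℝ).symm.toLinearMap ∘ₗ
        LinearMap.inl ℝ (Fin n → ℝ) (Fin m → ℝ)) fun x hx => by
      change Sum.elim x 0 ⬝ᵥ _ *ᵥ Sum.elim x 0 < 0
      simpa [fromBlocks_mulVec, sumElim_dotProduct_sumElim, neg_mulVec] using
        hE.dotProduct_mulVec_pos hx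
    simpa using this
  have hpos : m ≤ Fintype.card {i // 0 < hK.eigenvalues i} := by
    have := hK.finrank_le_card_eigenvalues_pos
      ((LinearEquiv.sumArrowLequivProdArrow (Fin n) (Fin m) ℝ ℝ).symm.toLinearMap ∘ₗ
        LinearMap.inr ℝ (Fin n → ℝ) (Fin m → ℝ)) fun x hx => by
      change 0 < Sum.elim 0 x ⬝ᵥ _ *ᵥ Sum.elim 0 x
      simpa [fromBlocks_mulVec, sumElim_dotProduct_sumElim] using hF.dotProduct_mulVec_pos hx
    simpa using this
  have hdisj : Disjoint (fun i => hK.eigenvalues i < 0) (fun i => 0 < hK.eigenvalues i) :=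
    Pi.disjoint_iff.2 fun i => Prop.disjoint_iff.2 <| by
      by_contra! h
      exact h.1.not_gt h.2
  have hor := Fintype.card_subtype_or_disjoint _ _ hdisj
  have hcompl := Fintype.card_subtype_compl
    (fun i => hK.eigenvalues i < 0 ∨ 0 < hK.eigenvalues i)
  have hle := Fintype.card_subtype_le (fun i => hK.eigenvalues i < 0 ∨ 0 < hK.eigenvalues i)
  rw [Fintype.card_sum, Fintype.card_fin, Fintype.card_fin] at hcompl hle
  refine ⟨by omega, by omega, fun i hi => ?_⟩
  have hempty := Fintype.card_eq_zero_iff.1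
    (show Fintype.card {i // ¬(hK.eigenvalues i < 0 ∨ 0 < hK.eigenvalues i)} = 0 by omega)
  exact hempty.false ⟨i, by simp [hi]⟩
end
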